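/- Let f ∈ Γ₀(ℝⁿ) with dom f ∩ dom φ ≠ ∅. Then the single-valued anisotropic proximal map aprox^φ f is continuous on dom f + U, and for every x ∈ dom f + U one has aprox^φ f(x) = (Id + ∇φ* ∘ ∂f)^{-1}(x), where ∂f is the convex subdifferential and ∇φ* the gradient of the (everywhere finite, differentiable) Fenchel conjugate φ*. -/

import Mathlib

open scoped RealInnerProductSpace Pointwise Topology Classical

noncomputable section

/-- Effective domain of an extended-real-valued function. -/
def edom {n : ℕ} (f : EuclideanSpace ℝ (Fin n) → EReal) : Set (EuclideanSpace ℝ (Fin n)) :=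
  {x | f x ≠ ⊤}

/-- Proper: nowhere `⊥` and not identically `⊤`. -/
def ProperFn {n : ℕ} (f : EuclideanSpace ℝ (Fin n) → EReal) : Prop :=
  (∀ x, f x ≠ ⊥) ∧ ∃ x, f x ≠ ⊤

/-- Convexity for extended-real-valued functions. -/
def ConvexFn {n : ℕ} (f : EuclideanSpace ℝ (Fin n) → EReal) : Prop :=
  ∀ x y : EuclideanSpace ℝ (Fin n), ∀ a b : ℝ, 0 ≤ a → 0 ≤ b → a + b = 1 →
    f (a • x + b • y) ≤ (a : EReal) * f x + (b : EReal) * f y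

/-- `Γ₀`: proper, lower semicontinuous, convex. -/
def Gamma0 {n : ℕ} (f : EuclideanSpace ℝ (Fin n) → EReal) : Prop :=
  ProperFn f ∧ LowerSemicontinuous f ∧ ConvexFn f

/-- Fenchel conjugate. -/
def fconj {n : ℕ} (f : EuclideanSpace ℝ (Fin n) → EReal) (y : EuclideanSpace ℝ (Fin n)) :
    EReal :=
  ⨆ x, ((⟪y, x⟫ : ℝ) : EReal) - f x

/-- Convex subdifferential. -/
def subdiff {n : ℕ} (f : EuclideanSpace ℝ (Fin n) → EReal) (x : EuclideanSpace ℝ (Fin n)) :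
    Set (EuclideanSpace ℝ (Fin n)) :=
  {u | ∀ y, f x + ((⟪u, y - x⟫ : ℝ) : EReal) ≤ f y}

/-- 1-coercive (supercoercive): `f x / ‖x‖ → ∞` as `‖x‖ → ∞`. -/
def SuperCoercive {n : ℕ} (f : EuclideanSpace ℝ (Fin n) → EReal) : Prop :=
  ∀ c : ℝ, ∃ R : ℝ, ∀ x, R ≤ ‖x‖ → ((c * ‖x‖ : ℝ) : EReal) ≤ f x

/-- Legendre-type function `φ` with gradient map `gφ` on `U = int (dom φ)`:
proper, lsc, convex, `U ≠ ∅`, differentiable on `U`, essentially smooth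
(gradient blows up along sequences approaching the boundary), and
essentially strictly convex (strictly convex on `U`). -/
structure IsLegendre {n : ℕ} (φ : EuclideanSpace ℝ (Fin n) → EReal)
    (gφ : EuclideanSpace ℝ (Fin n) → EuclideanSpace ℝ (Fin n)) : Prop where
  proper : ProperFn φ
  lsc : LowerSemicontinuous φ
  convex : ConvexFn φ
  intNonempty : (interior (edom φ)).Nonempty
  grad : ∀ x ∈ interior (edom φ), HasGradientAt (fun y => (φ y).toReal) (gφ x) x
  essSmooth : ∀ (u : ℕ → EuclideanSpace ℝ (Fin n)) (x : EuclideanSpace ℝ (Fin n)),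
      (∀ k, u k ∈ interior (edom φ)) → x ∈ frontier (edom φ) →
      Filter.Tendsto u Filter.atTop (nhds x) →
      Filter.Tendsto (fun k => ‖gφ (u k)‖) Filter.atTop Filter.atTop
  essStrictConvex : ∀ x ∈ interior (edom φ), ∀ y ∈ interior (edom φ), x ≠ y →
      ∀ a b : ℝ, 0 < a → 0 < b → a + b = 1 →
      φ (a • x + b • y) < (a : EReal) * φ x + (b : EReal) * φ y

/-- Bregman distance `D_φ`. -/
def bregman {n : ℕ} (φ : EuclideanSpace ℝ (Fin n) → EReal)
    (gφ : EuclideanSpace ℝ (Fin n) → EuclideanSpace ℝ (Fin n))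
    (x y : EuclideanSpace ℝ (Fin n)) : EReal :=
  if y ∈ interior (edom φ) then φ x - φ y - ((⟪gφ y, x - y⟫ : ℝ) : EReal) else ⊤

/-- Left Bregman envelope `env^φ_λ f`. -/
def benv {n : ℕ} (φ : EuclideanSpace ℝ (Fin n) → EReal)
    (gφ : EuclideanSpace ℝ (Fin n) → EuclideanSpace ℝ (Fin n)) (lam : ℝ)
    (f : EuclideanSpace ℝ (Fin n) → EReal) (y : EuclideanSpace ℝ (Fin n)) : EReal :=
  ⨅ x, f x + ((1 / lam : ℝ) : EReal) * bregman φ gφ x y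

/-- Left Bregman proximal map `prox^φ_λ f` (set of minimizers). -/
def bprox {n : ℕ} (φ : EuclideanSpace ℝ (Fin n) → EReal)
    (gφ : EuclideanSpace ℝ (Fin n) → EuclideanSpace ℝ (Fin n)) (lam : ℝ)
    (f : EuclideanSpace ℝ (Fin n) → EReal) (y : EuclideanSpace ℝ (Fin n)) :
    Set (EuclideanSpace ℝ (Fin n)) :=
  {x | f x + ((1 / lam : ℝ) : EReal) * bregman φ gφ x y ≠ ⊤ ∧
    ∀ z, f x + ((1 / lam : ℝ) : EReal) * bregman φ gφ x y ≤
      f z + ((1 / lam : ℝ) : EReal) * bregman φ gφ z y}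

/-- φ-prox-boundedness threshold `λ_f`. -/
def proxThreshold {n : ℕ} (φ : EuclideanSpace ℝ (Fin n) → EReal)
    (gφ : EuclideanSpace ℝ (Fin n) → EuclideanSpace ℝ (Fin n))
    (f : EuclideanSpace ℝ (Fin n) → EReal) : EReal :=
  sSup ((fun lam : ℝ => (lam : EReal)) ''
    {lam : ℝ | 0 < lam ∧ ∃ x, benv φ gφ lam f x ≠ ⊥})

/-- λ-φ-proximal hull: pointwise supremum of all minorants `c - (1/λ) D_φ(·, w)`. -/
def phull {n : ℕ} (φ : EuclideanSpace ℝ (Fin n) → EReal)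
    (gφ : EuclideanSpace ℝ (Fin n) → EuclideanSpace ℝ (Fin n)) (lam : ℝ)
    (f : EuclideanSpace ℝ (Fin n) → EReal) (x : EuclideanSpace ℝ (Fin n)) : EReal :=
  ⨆ (c : ℝ) (w : EuclideanSpace ℝ (Fin n)) (_ : w ∈ interior (edom φ))
    (_ : ∀ z, (c : EReal) - ((1 / lam : ℝ) : EReal) * bregman φ gφ z w ≤ f z),
    ((c : EReal) - ((1 / lam : ℝ) : EReal) * bregman φ gφ x w)

/-- Combettes–Reyes anisotropic envelope `f □ ψ`. -/
def aenv {n : ℕ} (ψ f : EuclideanSpace ℝ (Fin n) → EReal) (x : EuclideanSpace ℝ (Fin n)) :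
    EReal :=
  ⨅ y, f y + ψ (x - y)

/-- Combettes–Reyes anisotropic proximal map `aprox^ψ f`. -/
def aprox {n : ℕ} (ψ f : EuclideanSpace ℝ (Fin n) → EReal) (x : EuclideanSpace ℝ (Fin n)) :
    Set (EuclideanSpace ℝ (Fin n)) :=
  {y | f y + ψ (x - y) ≠ ⊤ ∧ ∀ z, f y + ψ (x - y) ≤ f z + ψ (x - z)}

/-- Subtraction with the conventions `⊤ - ⊤ = ⊤` and `⊤ - r = ⊤`. -/
def esub (a b : EReal) : EReal := if a = ⊤ then ⊤ else a - b

/-- Convex hull of a function: the largest convex minorant. -/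
def convFn {n : ℕ} (f : EuclideanSpace ℝ (Fin n) → EReal) (x : EuclideanSpace ℝ (Fin n)) :
    EReal :=
  ⨆ (g : EuclideanSpace ℝ (Fin n) → EReal) (_ : ConvexFn g ∧ ∀ y, g y ≤ f y), g x

/-- Epi-multiplication `μ ⋆ g`. -/
def epiMul {n : ℕ} (μ : ℝ) (g : EuclideanSpace ℝ (Fin n) → EReal)
    (x : EuclideanSpace ℝ (Fin n)) : EReal :=
  if 0 < μ then (μ : EReal) * g ((1 / μ) • x) else (if x = 0 then 0 else ⊤)

/-- Infimal convolution. -/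
def infConv {n : ℕ} (g h : EuclideanSpace ℝ (Fin n) → EReal)
    (x : EuclideanSpace ℝ (Fin n)) : EReal :=
  ⨅ u, g u + h (x - u)

/-- The α-weighted Bregman proximal average with parameter λ. -/
def pavg {n : ℕ} (φ : EuclideanSpace ℝ (Fin n) → EReal) (lam α : ℝ)
    (f1 f2 : EuclideanSpace ℝ (Fin n) → EReal) (x : EuclideanSpace ℝ (Fin n)) : EReal :=
  esub
    (fconj (fun y =>
      (α : EReal) * fconj (fun z => f1 z + ((1 / lam : ℝ) : EReal) * φ z) y
        + ((1 - α : ℝ) : EReal) * fconj (fun z => f2 z + ((1 / lam : ℝ) : EReal) * φ z) y) x)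
    (((1 / lam : ℝ) : EReal) * φ x)

/-- Argmin set of an extended-real-valued function. -/
def argminSet {n : ℕ} (f : EuclideanSpace ℝ (Fin n) → EReal) :
    Set (EuclideanSpace ℝ (Fin n)) :=
  {x | f x ≠ ⊤ ∧ ∀ y, f x ≤ f y}

section AnisotropicProx

open Filter Set

variable {n : ℕ} {f φ : EuclideanSpace ℝ (Fin n) → EReal}

lemma ProperFn.coe_toReal (hf : ProperFn f) {x : EuclideanSpace ℝ (Fin n)} (hx : x ∈ edom f) :
    (((f x).toReal : ℝ) : EReal) = f x :=
  EReal.coe_toReal hx (hf.1 x)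

lemma ConvexFn.lineMap_le (hf : ProperFn f) (hc : ConvexFn f) {x y : EuclideanSpace ℝ (Fin n)}
    (hx : x ∈ edom f) (hy : y ∈ edom f) {t : ℝ} (h0 : 0 ≤ t) (h1 : t ≤ 1) :
    x + t • (y - x) ∈ edom f ∧
      (f (x + t • (y - x))).toReal ≤ (f x).toReal + t * ((f y).toReal - (f x).toReal) := by
  have h := hc x y (1 - t) t (by linarith) h0 (by ring)
  have e : (1 - t) • x + t • y = x + t • (y - x) := by module
  rw [e, ← hf.coe_toReal hx, ← hf.coe_toReal hy, ← EReal.coe_mul, ← EReal.coe_mul,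
    ← EReal.coe_add] at h
  have hm : x + t • (y - x) ∈ edom f := fun ht => by
    rw [ht] at h
    exact EReal.coe_ne_top _ (top_le_iff.1 h)
  rw [← hf.coe_toReal hm, EReal.coe_le_coe_iff] at h
  exact ⟨hm, by linarith⟩

lemma ConvexFn.convex_edom (hf : ProperFn f) (hc : ConvexFn f) : Convex ℝ (edom f) :=
  convex_iff_add_mem.2 fun x hx y hy a b ha hb hab => by
    have := (hc.lineMap_le hf hx hy hb (by linarith)).1
    have e : x + b • (y - x) = a • x + b • y := by
      rw [← eq_sub_iff_add_eq] at hab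
      subst hab
      module
    rwa [e] at this

/-- A function in `Γ₀` has a continuous affine minorant. -/
lemma Gamma0.exists_affine_le (hf : Gamma0 f) :
    ∃ (v : EuclideanSpace ℝ (Fin n)) (c : ℝ), ∀ y, ((⟪v, y⟫ + c : ℝ) : EReal) ≤ f y := by
  obtain ⟨hp, hl, hc⟩ := hf
  obtain ⟨a, ha⟩ := hp.2
  set S : Set (EuclideanSpace ℝ (Fin n) × ℝ) := {p | f p.1 ≤ (p.2 : EReal)} with hS
  have hclosed : IsClosed S :=
    hl.isClosed_epigraph.preimage
      (continuous_fst.prodMk (continuous_coe_real_ereal.comp continuous_snd))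
  have hmem : ∀ p ∈ S, p.1 ∈ edom f ∧ (f p.1).toReal ≤ p.2 := fun p hpS => by
    have hd : p.1 ∈ edom f := ne_top_of_le_ne_top (EReal.coe_ne_top _) hpS
    refine ⟨hd, ?_⟩
    have : f p.1 ≤ (p.2 : EReal) := hpS
    rwa [← hp.coe_toReal hd, EReal.coe_le_coe_iff] at this
  have hconv : Convex ℝ S := by
    refine convex_iff_add_mem.2 fun p hp' q hq' s t hs ht hst => ?_
    obtain ⟨hp1, hp2⟩ := hmem p hp'
    obtain ⟨hq1, hq2⟩ := hmem q hq'
    have h := hc p.1 q.1 s t hs ht hst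
    rw [← hp.coe_toReal hp1, ← hp.coe_toReal hq1, ← EReal.coe_mul, ← EReal.coe_mul,
      ← EReal.coe_add] at h
    refine h.trans (EReal.coe_le_coe_iff.2 ?_)
    have := mul_le_mul_of_nonneg_left hp2 hs
    have := mul_le_mul_of_nonneg_left hq2 ht
    simp only [Prod.snd_add, Prod.smul_snd, smul_eq_mul]
    linarith
  have hnot : (a, (f a).toReal - 1) ∉ S := fun h => by
    have := (hmem _ h).2
    simp at this
    linarith
  obtain ⟨L, u, hLu, hL⟩ := geometric_hahn_banach_point_closed hconv hclosed hnot
  have hdecomp : ∀ y r, L (y, r) = L (y, 0) + r * L (0, 1) := fun y r => by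
    rw [← smul_eq_mul, ← map_smul, ← map_add]
    simp
  have hs : 0 < L (0, 1) := by
    have h1 := hL (a, (f a).toReal) (hp.coe_toReal ha).ge
    rw [hdecomp] at h1 hLu
    linarith
  set s := L (0, 1)
  set ℓ : EuclideanSpace ℝ (Fin n) →L[ℝ] ℝ := L.comp (ContinuousLinearMap.inl ℝ _ ℝ)
  refine ⟨-s⁻¹ • (InnerProductSpace.toDual ℝ _).symm ℓ, u / s, fun y => ?_⟩
  by_cases hy : f y = ⊤
  · simp [hy]
  have h := hL (y, (f y).toReal) (hp.coe_toReal hy).ge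
  rw [hdecomp] at h
  rw [← hp.coe_toReal hy, EReal.coe_le_coe_iff, inner_smul_left,
    InnerProductSpace.toDual_symm_apply]
  have hl : ℓ y = L (y, 0) := rfl
  rw [hl]
  have : (f y).toReal = s⁻¹ * ((f y).toReal * s) := by field_simp
  rw [this, div_eq_inv_mul]
  have := mul_le_mul_of_nonneg_left h.le (inv_nonneg.2 hs.le)
  simp
  linarith

/-- A supercoercive function dominates an affine one, uniformly under bounded translations. -/
lemma SuperCoercive.norm_le_of_add_le (hφ : SuperCoercive φ) {v : EuclideanSpace ℝ (Fin n)}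
    {c : ℝ} (hf : ∀ y, ((⟪v, y⟫ + c : ℝ) : EReal) ≤ f y) (r C : ℝ) :
    ∃ R : ℝ, ∀ x y, ‖x‖ ≤ r → f y + φ (x - y) ≤ (C : EReal) → ‖y‖ ≤ R := by
  obtain ⟨R₁, hR₁⟩ := hφ (‖v‖ + 1)
  refine ⟨max (R₁ + r) (C - c + (‖v‖ + 1) * r), fun x y hx h => ?_⟩
  by_contra! hy
  obtain ⟨h1, h2⟩ := max_lt_iff.1 hy
  have htri : ‖y‖ - r ≤ ‖x - y‖ := by
    have := norm_sub_norm_le y x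
    rw [norm_sub_rev] at this
    linarith
  have hsum := (add_le_add (hf y) (hR₁ (x - y) (by linarith))).trans h
  rw [← EReal.coe_add, EReal.coe_le_coe_iff] at hsum
  have hin := (abs_le.1 (abs_real_inner_le_norm v y)).1
  have := mul_le_mul_of_nonneg_left htri (by positivity : 0 ≤ ‖v‖ + 1)
  nlinarith

lemma lowerSemicontinuous_add_sub (hf : ProperFn f) (hfl : LowerSemicontinuous f)
    (hφ : ProperFn φ) (hφl : LowerSemicontinuous φ) :
    LowerSemicontinuous
      fun p : EuclideanSpace ℝ (Fin n) × EuclideanSpace ℝ (Fin n) => f p.2 + φ (p.1 - p.2) :=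
  LowerSemicontinuous.add' (LowerSemicontinuous.comp hfl continuous_snd)
    (LowerSemicontinuous.comp hφl (continuous_fst.sub continuous_snd))
    fun _ => EReal.continuousAt_add (.inr (hφ.1 _)) (.inl (hf.1 _))

lemma exists_mem_aprox (hf : ProperFn f) (hfl : LowerSemicontinuous f)
    (hφ : ProperFn φ) (hφl : LowerSemicontinuous φ) (hφco : SuperCoercive φ)
    {v : EuclideanSpace ℝ (Fin n)} {c : ℝ} (hvc : ∀ y, ((⟪v, y⟫ + c : ℝ) : EReal) ≤ f y)
    {x a : EuclideanSpace ℝ (Fin n)} (ha : a ∈ edom f) (hb : x - a ∈ edom φ) :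
    (aprox φ f x).Nonempty := by
  have hC : f a + φ (x - a) = (((f a).toReal + (φ (x - a)).toReal : ℝ) : EReal) := by
    rw [EReal.coe_add, hf.coe_toReal ha, hφ.coe_toReal hb]
  obtain ⟨R, hR⟩ := hφco.norm_le_of_add_le hvc ‖x‖ ((f a).toReal + (φ (x - a)).toReal)
  have haR : a ∈ Metric.closedBall (0 : EuclideanSpace ℝ (Fin n)) R := by
    simpa using hR x a le_rfl hC.le
  have hl : LowerSemicontinuous fun y => f y + φ (x - y) :=
    LowerSemicontinuous.comp (lowerSemicontinuous_add_sub hf hfl hφ hφl)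
      (continuous_const.prodMk continuous_id)
  obtain ⟨y, -, hy⟩ := LowerSemicontinuousOn.exists_isMinOn ⟨a, haR⟩
    (isCompact_closedBall _ _) (hl.lowerSemicontinuousOn _)
  have hya : f y + φ (x - y) ≤ f a + φ (x - a) := hy haR
  refine ⟨y, ne_top_of_le_ne_top (by rw [hC]; exact EReal.coe_ne_top _) hya, fun z => ?_⟩
  by_cases hz : z ∈ Metric.closedBall (0 : EuclideanSpace ℝ (Fin n)) R
  · exact hy hz
  · refine hya.trans ?_
    rw [hC]
    by_contra! h
    exact hz (by simpa using hR x z le_rfl h.le)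

lemma mem_aprox_iff (hf : ProperFn f) (hφ : ProperFn φ) {x y : EuclideanSpace ℝ (Fin n)} :
    y ∈ aprox φ f x ↔ y ∈ edom f ∧ x - y ∈ edom φ ∧ ∀ z ∈ edom f, x - z ∈ edom φ →
      (f y).toReal + (φ (x - y)).toReal ≤ (f z).toReal + (φ (x - z)).toReal := by
  have hiff : ∀ z, f z + φ (x - z) ≠ ⊤ ↔ z ∈ edom f ∧ x - z ∈ edom φ := fun z =>
    EReal.add_ne_top_iff_ne_top₂ (hf.1 _) (hφ.1 _)
  have hreal : ∀ z, z ∈ edom f → x - z ∈ edom φ →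
      f z + φ (x - z) = (((f z).toReal + (φ (x - z)).toReal : ℝ) : EReal) := fun z h1 h2 => by
    rw [EReal.coe_add, hf.coe_toReal h1, hφ.coe_toReal h2]
  change f y + φ (x - y) ≠ ⊤ ∧ _ ↔ _
  rw [hiff, and_assoc]
  refine and_congr_right fun h1 => and_congr_right fun h2 => ⟨fun h z hz1 hz2 => ?_, fun h z => ?_⟩
  · have := h z
    rwa [hreal y h1 h2, hreal z hz1 hz2, EReal.coe_le_coe_iff] at this
  · by_cases hz : f z + φ (x - z) = ⊤
    · rw [hz]
      exact le_top
    · obtain ⟨hz1, hz2⟩ := (hiff z).1 hz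
      rw [hreal y h1 h2, hreal z hz1 hz2, EReal.coe_le_coe_iff]
      exact h z hz1 hz2

/-- A linear lower bound on forward differences bounds the directional derivative below. -/
lemma HasGradientAt.le_inner_of_eventually_mul_le {h : EuclideanSpace ℝ (Fin n) → ℝ}
    {g p d : EuclideanSpace ℝ (Fin n)} (hg : HasGradientAt h g p) {c : ℝ}
    (hc : ∀ᶠ t : ℝ in 𝓝[>] 0, t * c ≤ h (p + t • d) - h p) : c ≤ ⟪g, d⟫ := by
  have hline : HasDerivAt (fun t : ℝ => h (p + t • d)) ⟪g, d⟫ 0 := by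
    have h1 : HasFDerivAt h (InnerProductSpace.toDual ℝ _ g) (p + (0 : ℝ) • d) := by
      simpa using hg.hasFDerivAt
    have h2 : HasDerivAt (fun t : ℝ => p + t • d) d 0 := by
      simpa using ((hasDerivAt_id (0 : ℝ)).smul_const d).const_add p
    exact h1.comp_hasDerivAt (0 : ℝ) h2
  have htend := hline.tendsto_slope_zero_right
  refine ge_of_tendsto htend ?_
  filter_upwards [hc, self_mem_nhdsWithin] with t hct ht
  simp only [zero_add, zero_smul, add_zero, smul_eq_mul]
  rw [inv_mul_eq_div, le_div_iff₀ ht]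
  linarith

variable {gφ : EuclideanSpace ℝ (Fin n) → EuclideanSpace ℝ (Fin n)}

lemma IsLegendre.gradient_inequality (hφ : IsLegendre φ gφ) {p w : EuclideanSpace ℝ (Fin n)}
    (hp : p ∈ interior (edom φ)) (hw : w ∈ edom φ) :
    (φ p).toReal + ⟪gφ p, w - p⟫ ≤ (φ w).toReal := by
  have hg : HasGradientAt (fun y => -(φ y).toReal) (-gφ p) p := by
    have := (hφ.grad p hp).hasFDerivAt.neg
    rw [hasGradientAt_iff_hasFDerivAt, map_neg]
    exact this
  have := hg.le_inner_of_eventually_mul_le (d := w - p) (c := -((φ w).toReal - (φ p).toReal))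
    (by
      filter_upwards [Ioc_mem_nhdsGT (zero_lt_one (α := ℝ))] with t ht
      have := (hφ.convex.lineMap_le hφ.proper (interior_subset hp) hw ht.1.le ht.2).2
      linarith)
  rw [inner_neg_left] at this
  linarith

lemma IsLegendre.continuousAt (hφ : IsLegendre φ gφ) {p : EuclideanSpace ℝ (Fin n)}
    (hp : p ∈ interior (edom φ)) : ContinuousAt (fun y => (φ y).toReal) p :=
  (hφ.grad p hp).hasFDerivAt.continuousAt

/-- Approaching a boundary point of the domain from the interior, the gradient of a Legendre
function makes directional derivatives arbitrarily negative. -/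
lemma IsLegendre.exists_inner_lt (hφ : IsLegendre φ gφ) {p b : EuclideanSpace ℝ (Fin n)}
    (hp : p ∈ edom φ) (hp' : p ∉ interior (edom φ)) (hb : b ∈ interior (edom φ)) (C : ℝ) :
    ∃ t : ℝ, 0 < t ∧ t ≤ 1 ∧ ⟪gφ (p + t • (b - p)), b - p⟫ < C := by
  obtain ⟨t, -, ht, htl⟩ := exists_seq_strictAnti_tendsto' (zero_lt_one (α := ℝ))
  have hz : ∀ k, p + t k • (b - p) ∈ interior (edom φ) := fun k =>
    (hφ.convex.convex_edom hφ.proper).add_smul_sub_mem_interior hp hb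
      ⟨(ht k).1, (ht k).2.le⟩
  have hzl : Tendsto (fun k => p + t k • (b - p)) atTop (𝓝 p) := by
    simpa using (htl.smul_const (b - p)).const_add p
  have hblow := hφ.essSmooth _ p hz ⟨subset_closure hp, hp'⟩ hzl
  obtain ⟨r, hr, hball⟩ : ∃ r > 0, ∀ w, dist w b ≤ r →
      w ∈ interior (edom φ) ∧ (φ w).toReal < (φ b).toReal + 1 := by
    have hev : ∀ᶠ w in 𝓝 b, w ∈ interior (edom φ) ∧ (φ w).toReal < (φ b).toReal + 1 :=
      (isOpen_interior.eventually_mem hb).and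
        ((hφ.continuousAt hb).eventually_lt_const (by linarith))
    obtain ⟨r, hr, h⟩ := Metric.nhds_basis_closedBall.eventually_iff.1 hev
    exact ⟨r, hr, fun w hw => h hw⟩
  have hlow : ∀ᶠ k in atTop, (φ p).toReal - 1 < (φ (p + t k • (b - p))).toReal := by
    have h1 : (((φ p).toReal - 1 : ℝ) : EReal) < φ p := by
      conv_rhs => rw [← hφ.proper.coe_toReal hp]
      exact EReal.coe_lt_coe_iff.2 (by linarith)
    filter_upwards [hzl.eventually (hφ.lsc p _ h1)] with k hk
    rwa [← hφ.proper.coe_toReal (interior_subset (hz k)), gt_iff_lt, EReal.coe_lt_coe_iff] at hk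
  obtain ⟨k, hk1, hk2⟩ := (hlow.and
    (hblow.eventually_gt_atTop (((φ b).toReal - (φ p).toReal + 2 + |C|) / r))).exists
  refine ⟨t k, (ht k).1, (ht k).2.le, ?_⟩
  by_contra! hC
  set z := p + t k • (b - p) with hzdef
  set g := gφ z
  rw [div_lt_iff₀ hr] at hk2
  have hg0 : ‖g‖ ≠ 0 ∨ ‖g‖ = 0 := ne_or_eq _ _
  have hw := hball (b + (r / ‖g‖) • g) (by
    rw [dist_eq_norm, add_sub_cancel_left, norm_smul, norm_div, Real.norm_of_nonneg hr.le,
      norm_norm]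
    rcases hg0 with h | h
    · rw [div_mul_cancel₀ _ h]
    · simp [h, hr.le])
  have hgi := hφ.gradient_inequality (hz k) (interior_subset hw.1)
  have hsplit : b + (r / ‖g‖) • g - z = (1 - t k) • (b - p) + (r / ‖g‖) • g := by
    rw [hzdef]
    module
  have hgg : (r / ‖g‖) * (‖g‖ * ‖g‖) = ‖g‖ * r := by
    rcases hg0 with h | h
    · field_simp
    · simp [h]
  change (φ z).toReal + ⟪g, _⟫ ≤ _ at hgi
  rw [hsplit, inner_add_right, inner_smul_right, inner_smul_right, real_inner_self_eq_norm_mul_norm,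
    hgg] at hgi
  have h1 : -|C| ≤ (1 - t k) * ⟪g, b - p⟫ := by
    have h2 : -|C| ≤ ⟪g, b - p⟫ := (neg_abs_le C).trans hC
    have h3 := mul_le_mul_of_nonneg_left h2 (by linarith [(ht k).2] : 0 ≤ 1 - t k)
    nlinarith [abs_nonneg C, (ht k).1]
  linarith [hw.2]

lemma IsLegendre.sub_mem_interior_of_mem_aprox (hφ : IsLegendre φ gφ) (hf : ProperFn f)
    (hfc : ConvexFn f) {x y : EuclideanSpace ℝ (Fin n)}
    (hx : x ∈ edom f + interior (edom φ)) (hy : y ∈ aprox φ f x) :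
    x - y ∈ interior (edom φ) := by
  obtain ⟨a, ha, b, hb, rfl⟩ := hx
  dsimp only at *
  obtain ⟨hy1, hy2, hmin⟩ := (mem_aprox_iff hf hφ.proper).1 hy
  by_contra hnot
  obtain ⟨t, h0, h1, ht⟩ := hφ.exists_inner_lt hy2 hnot hb ((f y).toReal - (f a).toReal)
  have hfa := hfc.lineMap_le hf hy1 ha h0.le h1
  have hz : a + b - (y + t • (a - y)) = a + b - y + t • (b - (a + b - y)) := by module
  have hzU := (hφ.convex.convex_edom hφ.proper).add_smul_sub_mem_interior hy2 hb ⟨h0, h1⟩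
  have hm := hmin (y + t • (a - y)) hfa.1 (by rw [hz]; exact interior_subset hzU)
  rw [hz] at hm
  have hgi := hφ.gradient_inequality hzU hy2
  rw [sub_add_cancel_left, inner_neg_right, inner_smul_right] at hgi
  nlinarith [hfa.2]

lemma IsLegendre.aprox_subsingleton (hφ : IsLegendre φ gφ) (hf : ProperFn f)
    (hfc : ConvexFn f) {x : EuclideanSpace ℝ (Fin n)}
    (hx : x ∈ edom f + interior (edom φ)) : (aprox φ f x).Subsingleton := by
  intro y hy z hz
  by_contra hne
  have hyU := hφ.sub_mem_interior_of_mem_aprox hf hfc hx hy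
  have hzU := hφ.sub_mem_interior_of_mem_aprox hf hfc hx hz
  obtain ⟨hy1, hy2, hymin⟩ := (mem_aprox_iff hf hφ.proper).1 hy
  obtain ⟨hz1, hz2, hzmin⟩ := (mem_aprox_iff hf hφ.proper).1 hz
  have hs := hφ.essStrictConvex _ hyU _ hzU (fun h => hne (by simpa using h)) (1 / 2) (1 / 2)
    (by norm_num) (by norm_num) (by norm_num)
  have hm := hfc.lineMap_le hf hy1 hz1 (t := 1 / 2) (by norm_num) (by norm_num)
  have e : (1 / 2 : ℝ) • (x - y) + (1 / 2 : ℝ) • (x - z) = x - (y + (1 / 2 : ℝ) • (z - y)) := by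
    module
  rw [e, ← hφ.proper.coe_toReal hy2, ← hφ.proper.coe_toReal hz2, ← EReal.coe_mul, ← EReal.coe_mul,
    ← EReal.coe_add] at hs
  have hd : x - (y + (1 / 2 : ℝ) • (z - y)) ∈ edom φ := ne_top_of_lt hs
  rw [← hφ.proper.coe_toReal hd, EReal.coe_lt_coe_iff] at hs
  have := hymin _ hm.1 hd
  have := hzmin _ hy1 hy2
  linarith [hm.2]

lemma IsLegendre.gradient_mem_subdiff (hφ : IsLegendre φ gφ) (hf : ProperFn f)
    (hfc : ConvexFn f) {x y : EuclideanSpace ℝ (Fin n)} (hy : y ∈ aprox φ f x)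
    (hU : x - y ∈ interior (edom φ)) : gφ (x - y) ∈ subdiff f y := by
  obtain ⟨hy1, hy2, hmin⟩ := (mem_aprox_iff hf hφ.proper).1 hy
  intro z
  by_cases hz : f z = ⊤
  · simp [hz]
  rw [← hf.coe_toReal hy1, ← hf.coe_toReal hz, ← EReal.coe_add, EReal.coe_le_coe_iff]
  have hline : Tendsto (fun t : ℝ => x - y + t • -(z - y)) (𝓝[>] 0) (𝓝 (x - y)) := by
    have : Continuous fun t : ℝ => x - y + t • -(z - y) := by fun_prop
    exact tendsto_nhdsWithin_of_tendsto_nhds (by simpa using this.tendsto 0)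
  have := (hφ.grad _ hU).le_inner_of_eventually_mul_le (d := -(z - y))
    (c := -((f z).toReal - (f y).toReal)) (by
      filter_upwards [Ioc_mem_nhdsGT (zero_lt_one (α := ℝ)),
        hline.eventually_mem (isOpen_interior.mem_nhds hU)] with t ht htU
      obtain ⟨hd, hle⟩ := hfc.lineMap_le hf hy1 hz ht.1.le ht.2
      have e : x - (y + t • (z - y)) = x - y + t • -(z - y) := by module
      have := hmin _ hd (by rw [e]; exact interior_subset htU)
      rw [e] at this
      linarith)
  rw [inner_neg_right] at this
  linarith

/-- The gradient of the conjugate at a subgradient recovers the point. -/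
lemma gradient_fconj_eq (hφ : ProperFn φ) (hφco : ∀ u, fconj φ u ≠ ⊤)
    {u g p : EuclideanSpace ℝ (Fin n)}
    (hg : HasGradientAt (fun z => (fconj φ z).toReal) g u) (hp : p ∈ edom φ)
    (hu : ∀ w ∈ edom φ, (φ p).toReal + ⟪u, w - p⟫ ≤ (φ w).toReal) : g = p := by
  have hlow : ∀ v, ((⟪v, p⟫ - (φ p).toReal : ℝ) : EReal) ≤ fconj φ v := fun v => by
    rw [EReal.coe_sub, hφ.coe_toReal hp]
    exact le_iSup (fun x => ((⟪v, x⟫ : ℝ) : EReal) - φ x) p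
  have hlow' : ∀ v, ⟪v, p⟫ - (φ p).toReal ≤ (fconj φ v).toReal := fun v => by
    have := EReal.toReal_le_toReal (hlow v) (EReal.coe_ne_bot _) (hφco v)
    rwa [EReal.toReal_coe] at this
  have hup : (fconj φ u).toReal ≤ ⟪u, p⟫ - (φ p).toReal := by
    have : fconj φ u ≤ ((⟪u, p⟫ - (φ p).toReal : ℝ) : EReal) := by
      refine iSup_le fun w => ?_
      by_cases hw : φ w = ⊤
      · simp [hw]
      rw [← hφ.coe_toReal hw, ← EReal.coe_sub, EReal.coe_le_coe_iff]
      have := hu w hw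
      rw [inner_sub_right] at this
      linarith
    have := EReal.toReal_le_toReal this
      (ne_bot_of_le_ne_bot (EReal.coe_ne_bot _) (hlow u)) (EReal.coe_ne_top _)
    rwa [EReal.toReal_coe] at this
  have key : ⟪p - g, p⟫ ≤ ⟪g, p - g⟫ := hg.le_inner_of_eventually_mul_le <| .of_forall fun t => by
    have := hlow' (u + t • (p - g))
    rw [inner_add_left, real_inner_smul_left] at this
    linarith
  rw [real_inner_comm, ← sub_nonpos, ← inner_sub_left, real_inner_self_nonpos, sub_eq_zero] at key
  exact key.symm

/-- For a supercoercive function the supremum defining the conjugate is attained. -/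
lemma SuperCoercive.exists_subgradient (hφco : SuperCoercive φ) (hφ : ProperFn φ)
    (hφl : LowerSemicontinuous φ) (u : EuclideanSpace ℝ (Fin n)) :
    ∃ p ∈ edom φ, ∀ w ∈ edom φ, (φ p).toReal + ⟪u, w - p⟫ ≤ (φ w).toReal := by
  obtain ⟨b, hb⟩ := hφ.2
  have hL : ProperFn fun y : EuclideanSpace ℝ (Fin n) => ((⟪u, y⟫ : ℝ) : EReal) :=
    ⟨fun _ => EReal.coe_ne_bot _, 0, EReal.coe_ne_top _⟩
  have hLl : LowerSemicontinuous fun y : EuclideanSpace ℝ (Fin n) => ((⟪u, y⟫ : ℝ) : EReal) :=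
    (continuous_coe_real_ereal.comp (continuous_const.inner continuous_id)).lowerSemicontinuous
  obtain ⟨y, hy⟩ := exists_mem_aprox (x := 0) (a := -b) hL hLl hφ hφl hφco (v := u) (c := 0)
    (fun y => by simp) (EReal.coe_ne_top _) (by simpa [edom] using hb)
  obtain ⟨-, h2, h3⟩ := (mem_aprox_iff hL hφ).1 hy
  refine ⟨0 - y, h2, fun w hw => ?_⟩
  have := h3 (-w) (EReal.coe_ne_top _) (by simpa using hw)
  simp only [EReal.toReal_coe, zero_sub, inner_neg_right, sub_neg_eq_add, zero_add,
    inner_add_right] at this ⊢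
  linarith

lemma SuperCoercive.fconj_ne_top (hφco : SuperCoercive φ) (hφ : ProperFn φ)
    (hφl : LowerSemicontinuous φ) (u : EuclideanSpace ℝ (Fin n)) : fconj φ u ≠ ⊤ := by
  obtain ⟨p, hp, hu⟩ := hφco.exists_subgradient hφ hφl u
  refine ne_top_of_le_ne_top (EReal.coe_ne_top (⟪u, p⟫ - (φ p).toReal)) (iSup_le fun w => ?_)
  by_cases hw : φ w = ⊤
  · simp [hw]
  rw [← hφ.coe_toReal hw, ← EReal.coe_sub, EReal.coe_le_coe_iff]
  have := hu w hw
  rw [inner_sub_right] at this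
  linarith

lemma mem_aprox_of_mem_subdiff (hf : ProperFn f) (hφ : ProperFn φ)
    {u x y : EuclideanSpace ℝ (Fin n)} (hu : u ∈ subdiff f y) (hp : x - y ∈ edom φ)
    (hup : ∀ w ∈ edom φ, (φ (x - y)).toReal + ⟪u, w - (x - y)⟫ ≤ (φ w).toReal) :
    y ∈ aprox φ f x := by
  have hy : y ∈ edom f := fun hy => by
    obtain ⟨a, ha⟩ := hf.2
    have := hu a
    rw [hy, EReal.top_add_coe, top_le_iff] at this
    exact ha this
  refine (mem_aprox_iff hf hφ).2 ⟨hy, hp, fun z hz hz' => ?_⟩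
  have h1 := hu z
  rw [← hf.coe_toReal hy, ← hf.coe_toReal hz, ← EReal.coe_add, EReal.coe_le_coe_iff] at h1
  have h2 := hup _ hz'
  rw [sub_sub_sub_cancel_left, ← neg_sub z y, inner_neg_right] at h2
  linarith

lemma IsLegendre.continuousOn_aprox (hφ : IsLegendre φ gφ) (hφco : SuperCoercive φ) (hf : Gamma0 f)
    {T : EuclideanSpace ℝ (Fin n) → EuclideanSpace ℝ (Fin n)}
    (hT : ∀ x ∈ edom f + interior (edom φ), aprox φ f x = {T x}) :
    ContinuousOn T (edom f + interior (edom φ)) := by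
  intro x hx
  obtain ⟨hp, hl, hc⟩ := hf
  have hmem : ∀ z ∈ edom f + interior (edom φ), T z ∈ aprox φ f z := fun z hz => by
    rw [hT z hz]
    rfl
  have hU := hφ.sub_mem_interior_of_mem_aprox hp hc hx (hmem x hx)
  obtain ⟨hy1, hy2, -⟩ := (mem_aprox_iff hp hφ.proper).1 (hmem x hx)
  have hsub : Tendsto (fun z => z - T x) (𝓝 x) (𝓝 (x - T x)) := tendsto_id.sub_const _
  have hupper : ∀ r : ℝ, f (T x) + φ (x - T x) < r →
      ∀ᶠ z in 𝓝[edom f + interior (edom φ)] x, f (T z) + φ (z - T z) < r := fun r hr => by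
    rw [← hp.coe_toReal hy1, ← hφ.proper.coe_toReal hy2, ← EReal.coe_add,
      EReal.coe_lt_coe_iff, ← lt_sub_iff_add_lt'] at hr
    have h1 := hsub.eventually ((hφ.continuousAt hU).eventually_lt_const hr)
    have h2 := hsub.eventually (isOpen_interior.mem_nhds hU)
    filter_upwards [nhdsWithin_le_nhds h1, nhdsWithin_le_nhds h2, self_mem_nhdsWithin]
      with z hz1 hz2 hz3
    refine ((hmem z hz3).2 (T x)).trans_lt ?_
    rw [← hp.coe_toReal hy1, ← hφ.proper.coe_toReal (interior_subset hz2), ← EReal.coe_add,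
      EReal.coe_lt_coe_iff]
    linarith
  obtain ⟨v, c, hvc⟩ := Gamma0.exists_affine_le ⟨hp, hl, hc⟩
  obtain ⟨C, hC, -⟩ := EReal.lt_iff_exists_real_btwn.1 (hmem x hx).1.lt_top
  obtain ⟨R, hR⟩ := hφco.norm_le_of_add_le hvc (‖x‖ + 1) C
  have hbdd : ∀ᶠ z in 𝓝[edom f + interior (edom φ)] x,
      T z ∈ Metric.closedBall (0 : EuclideanSpace ℝ (Fin n)) R := by
    have hn : ∀ᶠ z in 𝓝 x, ‖z‖ < ‖x‖ + 1 :=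
      continuous_norm.continuousAt.eventually_lt_const (by linarith)
    filter_upwards [hupper C hC, nhdsWithin_le_nhds hn] with z hz1 hz2
    simpa using hR z (T z) hz2.le hz1.le
  refine (isCompact_closedBall _ _).tendsto_nhds_of_unique_mapClusterPt hbdd fun y _ hy => ?_
  have hyx : y ∈ aprox φ f x := by
    have hle : f y + φ (x - y) ≤ f (T x) + φ (x - T x) := by
      by_contra! hlt
      obtain ⟨r, hr1, hr2⟩ := EReal.lt_iff_exists_real_btwn.1 hlt
      have hlsc := lowerSemicontinuous_add_sub hp hl hφ.proper hφ.lsc (x, y) r hr2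
      rw [nhds_prod_eq] at hlsc
      obtain ⟨P, hP, Q, hQ, hPQ⟩ := eventually_prod_iff.1 hlsc
      have hfreq := hy.frequently hQ
      obtain ⟨z, hz1, hz2, hz3⟩ :=
        (hfreq.and_eventually ((hP.filter_mono nhdsWithin_le_nhds).and (hupper r hr1))).exists
      exact lt_asymm hz3 (hPQ hz2 hz1)
    exact ⟨ne_top_of_le_ne_top (hmem x hx).1 hle, fun z => hle.trans ((hmem x hx).2 z)⟩
  rw [hT x hx] at hyx
  exact hyx

end AnisotropicProx

theorem aniso_prox_continuous_and_formula {n : ℕ}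
    (φ : EuclideanSpace ℝ (Fin n) → EReal)
    (gφ : EuclideanSpace ℝ (Fin n) → EuclideanSpace ℝ (Fin n))
    (hφ : IsLegendre φ gφ) (hφco : SuperCoercive φ)
    (gconj : EuclideanSpace ℝ (Fin n) → EuclideanSpace ℝ (Fin n))
    (hgconj : ∀ y, HasGradientAt (fun z => (fconj φ z).toReal) (gconj y) y)
    (f : EuclideanSpace ℝ (Fin n) → EReal) (hf : Gamma0 f)
    (hdom : (edom f ∩ edom φ).Nonempty) :
    ∃ T : EuclideanSpace ℝ (Fin n) → EuclideanSpace ℝ (Fin n),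
      ContinuousOn T (edom f + interior (edom φ)) ∧
      ∀ x ∈ edom f + interior (edom φ),
        aprox φ f x = {T x} ∧
        aprox φ f x = {y | ∃ u ∈ subdiff f y, y + gconj u = x} := by
  obtain ⟨v, c, hvc⟩ := hf.exists_affine_le
  obtain ⟨hp, hl, hc⟩ := hf
  have hne : ∀ x ∈ edom f + interior (edom φ), (aprox φ f x).Nonempty := by
    rintro _ ⟨a, ha, b, hb, rfl⟩
    exact exists_mem_aprox hp hl hφ.proper hφ.lsc hφco hvc ha
      (by simpa using interior_subset hb)
  have hsingle : ∀ x, ∃ y, x ∈ edom f + interior (edom φ) → aprox φ f x = {y} := fun x => by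
    by_cases hx : x ∈ edom f + interior (edom φ)
    · obtain ⟨y, hy⟩ := hne x hx
      exact ⟨y, fun _ => (hφ.aprox_subsingleton hp hc hx).eq_singleton_of_mem hy⟩
    · exact ⟨0, fun h => absurd h hx⟩
  choose T hT using hsingle
  have hfin := hφco.fconj_ne_top hφ.proper hφ.lsc
  refine ⟨T, hφ.continuousOn_aprox hφco ⟨hp, hl, hc⟩ hT, fun x hx => ⟨hT x hx, ?_⟩⟩
  ext y
  constructor
  · intro hy
    have hU := hφ.sub_mem_interior_of_mem_aprox hp hc hx hy
    refine ⟨gφ (x - y), hφ.gradient_mem_subdiff hp hc hy hU, ?_⟩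
    rw [gradient_fconj_eq hφ.proper hfin (hgconj _) (interior_subset hU)
      fun w hw => hφ.gradient_inequality hU hw]
    abel
  · rintro ⟨u, hu, rfl⟩
    obtain ⟨p, hp', hup⟩ := hφco.exists_subgradient hφ.proper hφ.lsc u
    have hg := gradient_fconj_eq hφ.proper hfin (hgconj u) hp' hup
    refine mem_aprox_of_mem_subdiff hp hφ.proper hu ?_ ?_ <;>
    · rw [add_sub_cancel_left, hg]
      assumption

end
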